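/- arXiv:2111.05320 — 2 statements merged into one kernel-verified Lean document; each statement's English description precedes it below -/
import Mathlib

section
/- Let M be a nonzero real symmetric n×n matrix, S ⊆ [n] and 0 ≤ ρ ≤ 1 be such that ‖M_{S×S}‖ ≤ ρ‖M‖. Let v ∈ ℝ^n be a unit vector with Mv = λv for some real λ with |λ| = ‖M‖ (a normalized top eigenvector). Then Σ_{i∉S} v_i² ≥ (1−ρ)² / (1 + (1−ρ)²). -/
open scoped BigOperators

/-- The spectral norm of a real `m × n` matrix: the supremum of `|uᵀ M v|`
over unit vectors `u ∈ ℝ^m`, `v ∈ ℝ^n`. -/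
noncomputable def specNorm {m n : ℕ} (M : Matrix (Fin m) (Fin n) ℝ) : ℝ :=
  sSup { x : ℝ | ∃ u : Fin m → ℝ, ∃ v : Fin n → ℝ,
    (∑ i, u i ^ 2) = 1 ∧ (∑ j, v j ^ 2) = 1 ∧ x = |∑ i, ∑ j, u i * M i j * v j| }

/-- `M_{S×S'}`: the matrix agreeing with `M` on `S × S'` and zero elsewhere. -/
def restrict {m n : ℕ} (M : Matrix (Fin m) (Fin n) ℝ)
    (S : Finset (Fin m)) (S' : Finset (Fin n)) : Matrix (Fin m) (Fin n) ℝ :=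
  fun i j => if i ∈ S ∧ j ∈ S' then M i j else 0

theorem abs_bilin_le_specNorm {m n : ℕ} (M : Matrix (Fin m) (Fin n) ℝ)
    {u : Fin m → ℝ} {v : Fin n → ℝ} (hu : ∑ i, u i ^ 2 = 1) (hv : ∑ j, v j ^ 2 = 1) :
    |∑ i, ∑ j, u i * M i j * v j| ≤ specNorm M := by
  have abs_le_one {k : ℕ} {w : Fin k → ℝ} (hw : ∑ i, w i ^ 2 = 1) (i : Fin k) : |w i| ≤ 1 := by
    rw [← sq_le_one_iff_abs_le_one, ← hw]
    exact Finset.single_le_sum (f := fun i => w i ^ 2) (fun _ _ => sq_nonneg _)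
      (Finset.mem_univ i)
  refine le_csSup ⟨∑ i, ∑ j, |M i j|, ?_⟩ ⟨u, v, hu, hv, rfl⟩
  rintro x ⟨u, v, hu, hv, rfl⟩
  refine (Finset.abs_sum_le_sum_abs _ _).trans (Finset.sum_le_sum fun i _ => ?_)
  refine (Finset.abs_sum_le_sum_abs _ _).trans (Finset.sum_le_sum fun j _ => ?_)
  rw [abs_mul, abs_mul]
  calc |u i| * |M i j| * |v j| ≤ 1 * |M i j| * 1 := by
        gcongr
        · exact abs_le_one hu i
        · exact abs_le_one hv j
    _ = |M i j| := by ring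

theorem abs_apply_le_specNorm {m n : ℕ} (M : Matrix (Fin m) (Fin n) ℝ) (i : Fin m) (j : Fin n) :
    |M i j| ≤ specNorm M := by
  simpa [Pi.single_apply] using abs_bilin_le_specNorm M (u := Pi.single i 1) (v := Pi.single j 1)
    (by simp [Pi.single_apply]) (by simp [Pi.single_apply])

theorem specNorm_pos {m n : ℕ} {M : Matrix (Fin m) (Fin n) ℝ} (hM : M ≠ 0) : 0 < specNorm M := by
  obtain ⟨i, j, hij⟩ : ∃ i j, M i j ≠ 0 := by
    by_contra! h
    exact hM (Matrix.ext h)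
  exact (abs_pos.2 hij).trans_le (abs_apply_le_specNorm M i j)

theorem abs_bilin_le_specNorm_mul {m n : ℕ} (M : Matrix (Fin m) (Fin n) ℝ)
    (u : Fin m → ℝ) (v : Fin n → ℝ) :
    |∑ i, ∑ j, u i * M i j * v j| ≤ specNorm M * (√(∑ i, u i ^ 2) * √(∑ j, v j ^ 2)) := by
  have eq_zero {k : ℕ} {w : Fin k → ℝ} (hw : √(∑ i, w i ^ 2) = 0) (i : Fin k) : w i = 0 := by
    have h := (Real.sqrt_eq_zero (Finset.sum_nonneg fun i _ => sq_nonneg (w i))).1 hw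
    exact pow_eq_zero_iff two_ne_zero |>.1 <|
      (Finset.sum_eq_zero_iff_of_nonneg fun i _ => sq_nonneg (w i)).1 h i (Finset.mem_univ i)
  have normalize {k : ℕ} {w : Fin k → ℝ} (hw : √(∑ i, w i ^ 2) ≠ 0) :
      ∑ i, (w i / √(∑ i, w i ^ 2)) ^ 2 = 1 := by
    have h : √(∑ i, w i ^ 2) ^ 2 = ∑ i, w i ^ 2 :=
      Real.sq_sqrt (Finset.sum_nonneg fun i _ => sq_nonneg (w i))
    simp_rw [div_pow]
    rw [← Finset.sum_div, h, div_self (h ▸ pow_ne_zero 2 hw)]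
  by_cases hu : √(∑ i, u i ^ 2) = 0
  · simp [eq_zero hu]
  by_cases hv : √(∑ j, v j ^ 2) = 0
  · simp [eq_zero hv]
  have h := abs_bilin_le_specNorm M (normalize hu) (normalize hv)
  set a := √(∑ i, u i ^ 2)
  set b := √(∑ j, v j ^ 2)
  have hab : 0 < a * b := by positivity
  have hscale : ∑ i, ∑ j, u i / a * M i j * (v j / b) =
      (∑ i, ∑ j, u i * M i j * v j) / (a * b) := by
    simp_rw [Finset.sum_div]
    refine Finset.sum_congr rfl fun i _ => Finset.sum_congr rfl fun j _ => ?_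
    field_simp
  rwa [hscale, abs_div, abs_of_pos hab, div_le_iff₀ hab] at h

/-- If `‖M_{S×S}‖ ≤ ρ‖M‖` and `v` is a normalized top eigenvector of the nonzero
symmetric matrix `M`, then `Σ_{i∉S} v_i² ≥ (1−ρ)² / (1 + (1−ρ)²)`. -/
theorem top_eigenvector_mass_outside {n : ℕ}
    (M : Matrix (Fin n) (Fin n) ℝ) (hM : M ≠ 0) (hsym : M.IsSymm)
    (S : Finset (Fin n)) (ρ : ℝ) (hρ0 : 0 ≤ ρ) (hρ1 : ρ ≤ 1)
    (hnorm : specNorm (restrict M S S) ≤ ρ * specNorm M)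
    (v : Fin n → ℝ) (hv : (∑ i, v i ^ 2) = 1)
    (lam : ℝ) (heig : M.mulVec v = lam • v) (hlam : |lam| = specNorm M) :
    (1 - ρ) ^ 2 / (1 + (1 - ρ) ^ 2) ≤ ∑ i ∈ Sᶜ, v i ^ 2 := by
  set x : Fin n → ℝ := fun i => if i ∈ S then v i else 0 with hx
  set y : Fin n → ℝ := fun i => if i ∈ S then 0 else v i with hy
  have hxsq : ∑ i, x i ^ 2 = ∑ i ∈ S, v i ^ 2 := by
    simp [hx, ite_pow, Finset.sum_ite_mem]
  have hysq : ∑ i, y i ^ 2 = ∑ i ∈ Sᶜ, v i ^ 2 := by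
    rw [← Finset.sum_add_sum_compl S (fun i => y i ^ 2),
      Finset.sum_eq_zero (s := S) fun i hi => by simp [hy, hi], zero_add]
    exact Finset.sum_congr rfl fun i hi => by simp [hy, Finset.mem_compl.1 hi]
  have hsplit : ∑ i ∈ S, v i ^ 2 + ∑ i ∈ Sᶜ, v i ^ 2 = 1 := by
    rw [Finset.sum_add_sum_compl, hv]
  have hquad : lam * ∑ i ∈ S, v i ^ 2 =
      ∑ i, ∑ j, x i * restrict M S S i j * x j + ∑ i, ∑ j, x i * M i j * y j := by
    rw [← hxsq, Finset.mul_sum, ← Finset.sum_add_distrib]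
    refine Finset.sum_congr rfl fun i _ => ?_
    have hi : ∑ j, M i j * v j = lam * v i := congrFun heig i
    rw [← Finset.sum_add_distrib]
    trans x i * ∑ j, M i j * v j
    · rw [hi]
      by_cases h : i ∈ S <;> simp [hx, h]
      ring
    · rw [Finset.mul_sum]
      refine Finset.sum_congr rfl fun j _ => ?_
      by_cases h : i ∈ S <;> by_cases h' : j ∈ S <;> simp [hx, hy, restrict, h, h', mul_assoc]
  have hpos := specNorm_pos hM
  have hxx := abs_bilin_le_specNorm_mul (restrict M S S) x x
  have hxy := abs_bilin_le_specNorm_mul M x y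
  have ha0 : 0 ≤ ∑ i ∈ S, v i ^ 2 := Finset.sum_nonneg fun i _ => sq_nonneg (v i)
  have hb0 : 0 ≤ ∑ i ∈ Sᶜ, v i ^ 2 := Finset.sum_nonneg fun i _ => sq_nonneg (v i)
  have habs := (abs_add_le _ _).trans (add_le_add hxx hxy)
  rw [← hquad, abs_mul, abs_of_nonneg ha0, hxsq, hysq, hlam, Real.mul_self_sqrt ha0] at habs
  set a := √(∑ i ∈ S, v i ^ 2) with ha
  set b := √(∑ i ∈ Sᶜ, v i ^ 2) with hb
  have ha2 : a ^ 2 = ∑ i ∈ S, v i ^ 2 := Real.sq_sqrt ha0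
  have hb2 : b ^ 2 = ∑ i ∈ Sᶜ, v i ^ 2 := Real.sq_sqrt hb0
  rw [← ha2, ← hb2] at hsplit
  rw [← ha2] at habs
  rw [← hb2, div_le_iff₀ (by positivity)]
  have ha_nonneg : 0 ≤ a := Real.sqrt_nonneg _
  have hb_nonneg : 0 ≤ b := Real.sqrt_nonneg _
  have hle : (1 - ρ) * a ≤ b := by
    rcases ha_nonneg.eq_or_lt with h | h
    · rw [← h, mul_zero]
      exact hb_nonneg
    · have hρ := mul_le_mul_of_nonneg_right hnorm (sq_nonneg a)
      refine le_of_mul_le_mul_left ?_ (mul_pos hpos h)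
      linarith
  have hsq := pow_le_pow_left₀ (mul_nonneg (sub_nonneg.2 hρ1) ha_nonneg) hle 2
  rw [mul_pow, eq_sub_of_add_eq hsplit] at hsq
  linarith
end

section
/- There exist universal constants c₂, c₃ > 0 such that the following holds. Let n ≥ 1, α₁ ∈ [1/n, 1/60] with 3α₁n an integer, η, κ ≥ 0, p ∈ ℝ, and let A be a real symmetric n×n matrix. Let F ⊆ [n] satisfy |[n]∖F| ≤ α₁n, the spectral regularity condition with bound η for A, and the density regularity condition at level 13α₁ with bound κ for A. Let S* ⊆ [n] satisfy |S*| ≥ (1 − 9α₁)n and ‖(A − p_{S*})_{S*×S*}‖ ≤ 20n·η. Let S^f ⊆ S* satisfy |S* ∖ S^f| = 3α₁n and |p_{S*} − p_{S*}^{(i)}| ≤ |p_{S*} − p_{S*}^{(j)}| for every i ∈ S^f and j ∈ S* ∖ S^f. Then |p_{S^f} − p| ≤ c₂·α₁·η + c₃·κ. -/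
open scoped BigOperators

/-- `p_S`: the empirical edge density `(Σ_{i,j∈S} A_{i,j}) / |S|²`. -/
noncomputable def pS {n : ℕ} (A : Matrix (Fin n) (Fin n) ℝ) (S : Finset (Fin n)) : ℝ :=
  (∑ i ∈ S, ∑ j ∈ S, A i j) / (S.card : ℝ) ^ 2

/-- `F` satisfies the spectral regularity condition with bound `η` for `A`:
for every `F' ⊆ F`, `‖(A − p)_{F'×F'}‖ ≤ n·η`. -/
def specReg {n : ℕ} (A : Matrix (Fin n) (Fin n) ℝ) (p η : ℝ) (F : Finset (Fin n)) : Prop :=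
  ∀ F' ⊆ F, specNorm (restrict (fun i j => A i j - p) F' F') ≤ (n : ℝ) * η

/-- `F` satisfies the density regularity condition at level `α₂` with bound `κ` for `A`. -/
def denReg {n : ℕ} (A : Matrix (Fin n) (Fin n) ℝ) (p α₂ κ : ℝ) (F : Finset (Fin n)) : Prop :=
  ∀ F' F'' : Finset (Fin n), F' ⊆ F → F'' ⊆ F →
    ((F'.card : ℝ) ≤ α₂ * n ∨ (n : ℝ) - α₂ * n ≤ (F'.card : ℝ)) →
    ((F''.card : ℝ) ≤ α₂ * n ∨ (n : ℝ) - α₂ * n ≤ (F''.card : ℝ)) →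
    |∑ i ∈ F', ∑ j ∈ F'', (A i j - p)| ≤ (n : ℝ) ^ 2 * κ

/-- `p_S^{(i)}`: the normalized degree of node `i` in the subgraph induced by `S`. -/
noncomputable def pSi {n : ℕ} (A : Matrix (Fin n) (Fin n) ℝ)
    (S : Finset (Fin n)) (i : Fin n) : ℝ :=
  (∑ j ∈ S, A i j) / (S.card : ℝ)

/-- The sum of the entries of `A - c` over the block `P × Q`. -/
def blockSum {n : ℕ} (A : Matrix (Fin n) (Fin n) ℝ) (c : ℝ) (P Q : Finset (Fin n)) : ℝ :=
  ∑ i ∈ P, ∑ j ∈ Q, (A i j - c)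

section blockSum

variable {n : ℕ} (A : Matrix (Fin n) (Fin n) ℝ)

theorem blockSum_shift (c d : ℝ) (P Q : Finset (Fin n)) :
    blockSum A c P Q = blockSum A d P Q + (P.card : ℝ) * Q.card * (d - c) := by
  simp only [blockSum, Finset.sum_sub_distrib, Finset.sum_const, nsmul_eq_mul]
  ring

theorem blockSum_inter_add_sdiff_right (c : ℝ) (P Q F : Finset (Fin n)) :
    blockSum A c P Q = blockSum A c P (Q ∩ F) + blockSum A c P (Q \ F) := by
  simp only [blockSum, ← Finset.sum_add_distrib, Finset.sum_inter_add_sum_sdiff]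

theorem blockSum_inter_add_sdiff_left (c : ℝ) (P Q F : Finset (Fin n)) :
    blockSum A c P Q = blockSum A c (P ∩ F) Q + blockSum A c (P \ F) Q := by
  simp only [blockSum, Finset.sum_inter_add_sum_sdiff]

theorem blockSum_comm (hA : A.IsSymm) (c : ℝ) (P Q : Finset (Fin n)) :
    blockSum A c P Q = blockSum A c Q P := by
  simp only [blockSum]
  rw [Finset.sum_comm]
  simp only [hA.apply]

end blockSum

theorem specNorm_bddAbove {m n : ℕ} (M : Matrix (Fin m) (Fin n) ℝ) :
    BddAbove { x : ℝ | ∃ u : Fin m → ℝ, ∃ v : Fin n → ℝ,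
      (∑ i, u i ^ 2) = 1 ∧ (∑ j, v j ^ 2) = 1 ∧ x = |∑ i, ∑ j, u i * M i j * v j| } := by
  refine ⟨∑ i, ∑ j, |M i j|, ?_⟩
  rintro x ⟨u, v, hu, hv, rfl⟩
  have hu' (i : Fin m) : |u i| ≤ 1 := by
    rw [← sq_le_one_iff_abs_le_one, ← hu]
    exact Finset.single_le_sum (f := fun i => u i ^ 2) (fun _ _ => sq_nonneg _)
      (Finset.mem_univ i)
  have hv' (j : Fin n) : |v j| ≤ 1 := by
    rw [← sq_le_one_iff_abs_le_one, ← hv]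
    exact Finset.single_le_sum (f := fun j => v j ^ 2) (fun _ _ => sq_nonneg _)
      (Finset.mem_univ j)
  refine (Finset.abs_sum_le_sum_abs _ _).trans (Finset.sum_le_sum fun i _ => ?_)
  refine (Finset.abs_sum_le_sum_abs _ _).trans (Finset.sum_le_sum fun j _ => ?_)
  rw [abs_mul, abs_mul]
  calc |u i| * |M i j| * |v j| ≤ 1 * |M i j| * 1 := by gcongr <;> simp [hu', hv']
    _ = |M i j| := by ring

theorem specNorm_nonneg {m n : ℕ} (M : Matrix (Fin m) (Fin n) ℝ) : 0 ≤ specNorm M := by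
  refine Real.sSup_nonneg ?_
  rintro x ⟨u, v, -, -, rfl⟩
  exact abs_nonneg _

theorem sum_sq_normalized_indicator {n : ℕ} {P : Finset (Fin n)} (hP : P.Nonempty) :
    ∑ i, (if i ∈ P then (√(P.card : ℝ))⁻¹ else 0) ^ 2 = 1 := by
  have : (P.card : ℝ) ≠ 0 := by exact_mod_cast hP.card_pos.ne'
  simp [ite_pow, this]

theorem abs_sum_block_le {n : ℕ} (M : Matrix (Fin n) (Fin n) ℝ) {S P Q : Finset (Fin n)}
    (hP : P ⊆ S) (hQ : Q ⊆ S) {a K : ℝ} (hPa : (P.card : ℝ) ≤ a) (hQa : (Q.card : ℝ) ≤ a)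
    (hK : specNorm (restrict M S S) ≤ K) :
    |∑ i ∈ P, ∑ j ∈ Q, M i j| ≤ K * a := by
  have hK0 : 0 ≤ K := (specNorm_nonneg _).trans hK
  have ha : 0 ≤ a := (Nat.cast_nonneg _).trans hPa
  rcases P.eq_empty_or_nonempty with rfl | hPn
  · simpa using mul_nonneg hK0 ha
  rcases Q.eq_empty_or_nonempty with rfl | hQn
  · simpa using mul_nonneg hK0 ha
  have hP0 : 0 < √(P.card : ℝ) := Real.sqrt_pos.2 (by exact_mod_cast hPn.card_pos)
  have hQ0 : 0 < √(Q.card : ℝ) := Real.sqrt_pos.2 (by exact_mod_cast hQn.card_pos)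
  have key := (le_csSup (specNorm_bddAbove (restrict M S S))
    ⟨fun i => if i ∈ P then (√(P.card : ℝ))⁻¹ else 0,
      fun j => if j ∈ Q then (√(Q.card : ℝ))⁻¹ else 0,
      sum_sq_normalized_indicator hPn, sum_sq_normalized_indicator hQn, rfl⟩).trans hK
  have hsum : ∑ i, ∑ j, (if i ∈ P then (√(P.card : ℝ))⁻¹ else 0) * restrict M S S i j *
      (if j ∈ Q then (√(Q.card : ℝ))⁻¹ else 0) =
      (√(P.card : ℝ))⁻¹ * (√(Q.card : ℝ))⁻¹ * ∑ i ∈ P, ∑ j ∈ Q, M i j := by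
    simp only [Finset.mul_sum]
    rw [← Finset.sum_subset (Finset.subset_univ P) (fun i _ hi => by simp [hi])]
    refine Finset.sum_congr rfl fun i hi => ?_
    rw [← Finset.sum_subset (Finset.subset_univ Q) (fun j _ hj => by simp [hj])]
    refine Finset.sum_congr rfl fun j hj => ?_
    simp only [hi, hj, if_true, restrict, hP hi, hQ hj, and_self]
    ring
  rw [hsum, abs_mul, abs_of_pos (by positivity), ← mul_inv, inv_mul_le_iff₀ (by positivity)]
    at key
  have hsq : √(P.card : ℝ) * √(Q.card : ℝ) ≤ a := by
    calc √(P.card : ℝ) * √(Q.card : ℝ) ≤ √a * √a := by gcongr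
      _ = a := Real.mul_self_sqrt ha
  calc _ ≤ _ := key
    _ ≤ a * K := by gcongr
    _ = K * a := mul_comm _ _

theorem sum_le_sum_of_card_le {ι : Type*} {Z T : Finset ι} {f : ι → ℝ} (hf : ∀ i, 0 ≤ f i)
    (hcard : Z.card ≤ T.card) (h : ∀ i ∈ Z, ∀ j ∈ T, f i ≤ f j) :
    ∑ i ∈ Z, f i ≤ ∑ j ∈ T, f j := by
  rcases T.eq_empty_or_nonempty with rfl | hT
  · simp_all
  obtain ⟨j, hj, hmin⟩ := T.exists_min_image f hT
  calc ∑ i ∈ Z, f i ≤ Z.card • f j := Finset.sum_le_card_nsmul _ _ _ fun i hi => h i hi j hj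
    _ ≤ T.card • f j := nsmul_le_nsmul_left (hf j) hcard
    _ ≤ ∑ j ∈ T, f j := Finset.card_nsmul_le_sum _ _ _ hmin

/-- Any finite set contains a subset of at least half its size on which `r` has constant sign. -/
theorem exists_half_subset_abs_sum_eq {ι : Type*} (T : Finset ι) (r : ι → ℝ) :
    ∃ T' ⊆ T, T.card ≤ 2 * T'.card ∧ ∑ j ∈ T', |r j| = |∑ j ∈ T', r j| := by
  classical
  have hcard := T.card_filter_add_card_filter_not (fun j => 0 ≤ r j)
  rcases le_total (T.filter fun j => ¬ 0 ≤ r j).card (T.filter fun j => 0 ≤ r j).card with h | h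
  · refine ⟨T.filter fun j => 0 ≤ r j, Finset.filter_subset _ _, by omega, ?_⟩
    rw [Finset.abs_sum_of_nonneg (fun j hj => (Finset.mem_filter.1 hj).2)]
    exact Finset.sum_congr rfl fun j hj => abs_of_nonneg (Finset.mem_filter.1 hj).2
  · refine ⟨T.filter fun j => ¬ 0 ≤ r j, Finset.filter_subset _ _, by omega, ?_⟩
    have hneg : ∀ j ∈ T.filter (fun j => ¬ 0 ≤ r j), r j ≤ 0 := fun j hj =>
      (not_le.1 (Finset.mem_filter.1 hj).2).le
    rw [abs_of_nonpos (Finset.sum_nonpos hneg), ← Finset.sum_neg_distrib]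
    exact Finset.sum_congr rfl fun j hj => abs_of_nonpos (hneg j hj)

/-- Theorem (fine trimming algorithm): there exist universal constants `c₂, c₃ > 0`
such that the trimmed empirical density satisfies `|p_{S^f} − p| ≤ c₂α₁η + c₃κ`. -/
theorem fine_trimming_estimate :
    ∃ c₂ : ℝ, 0 < c₂ ∧ ∃ c₃ : ℝ, 0 < c₃ ∧
      ∀ (n : ℕ), 1 ≤ n → ∀ (α₁ η κ : ℝ),
        1 / (n : ℝ) ≤ α₁ → α₁ ≤ 1 / 60 →
        (∃ k : ℕ, (k : ℝ) = 3 * α₁ * n) →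
        0 ≤ η → 0 ≤ κ → ∀ (p : ℝ),
        ∀ (A : Matrix (Fin n) (Fin n) ℝ), A.IsSymm →
        ∀ (F : Finset (Fin n)), ((Finset.univ \ F).card : ℝ) ≤ α₁ * n →
        specReg A p η F → denReg A p (13 * α₁) κ F →
        ∀ (Sstar : Finset (Fin n)), (1 - 9 * α₁) * n ≤ (Sstar.card : ℝ) →
        specNorm (restrict (fun i j => A i j - pS A Sstar) Sstar Sstar) ≤
          20 * n * η →
        ∀ (Sf : Finset (Fin n)), Sf ⊆ Sstar →
        ((Sstar \ Sf).card : ℝ) = 3 * α₁ * n →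
        (∀ i ∈ Sf, ∀ j ∈ Sstar \ Sf,
          |pS A Sstar - pSi A Sstar i| ≤ |pS A Sstar - pSi A Sstar j|) →
        |pS A Sf - p| ≤ c₂ * α₁ * η + c₃ * κ := by
  refine ⟨1000, by norm_num, 5, by norm_num, ?_⟩
  intro n hn α η κ hα hα' _ hη hκ p A hA F hF hspec hden S hS hnorm Sf hSf hcut htrim
  have hN : (0 : ℝ) < n := by exact_mod_cast hn
  have hα0 : 0 < α := lt_of_lt_of_le (by positivity) hα
  set N : ℝ := (n : ℝ)
  set x : ℝ := α * N with hx
  have hx0 : 0 < x := mul_pos hα0 hN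
  have hxN : 60 * x ≤ N := by rw [hx]; nlinarith
  set q : ℝ := pS A S
  have hcomp (P : Finset (Fin n)) : ((P \ F).card : ℝ) ≤ x :=
    le_trans (Nat.cast_le.2 (Finset.card_le_card
      (Finset.sdiff_subset_sdiff (Finset.subset_univ P) subset_rfl))) hF
  have hle (P : Finset (Fin n)) : (P.card : ℝ) ≤ N :=
    Nat.cast_le.2 ((Finset.card_le_univ P).trans_eq (Fintype.card_fin n))
  have hsplit (P Q : Finset (Fin n)) : ((P ∩ Q).card : ℝ) + (P \ Q).card = P.card := by
    exact_mod_cast Finset.card_inter_add_card_sdiff P Q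
  have hcut' : ((S \ Sf).card : ℝ) = 3 * x := by rw [hcut, hx]; ring
  have hScard : N - 9 * x ≤ (S.card : ℝ) := by rw [hx]; linarith
  have hSfcard : (Sf.card : ℝ) = S.card - 3 * x := by
    have := hsplit S Sf
    rw [Finset.inter_eq_right.2 hSf] at this
    linarith
  have hStarBlock {P Q : Finset (Fin n)} {a : ℝ} (hP : P ⊆ S) (hQ : Q ⊆ S)
      (hPa : (P.card : ℝ) ≤ a) (hQa : (Q.card : ℝ) ≤ a) :
      |blockSum A q P Q| ≤ 20 * N * η * a :=
    abs_sum_block_le (fun i j => A i j - q) hP hQ hPa hQa hnorm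
  -- the density of `S` is within `O(η)` of `p`
  have hq : |q - p| ≤ 26 * η := by
    set G := S ∩ F
    have hG : 5 / 6 * N ≤ (G.card : ℝ) := by linarith [hsplit S F, hcomp S]
    have h₁ : |blockSum A q G G| ≤ 20 * N * η * G.card :=
      hStarBlock Finset.inter_subset_left Finset.inter_subset_left le_rfl le_rfl
    have h₂ : |blockSum A p G G| ≤ N * η * G.card :=
      abs_sum_block_le (fun i j => A i j - p) subset_rfl subset_rfl le_rfl le_rfl
        (hspec G Finset.inter_subset_right)
    have hG0 : (0 : ℝ) < G.card := lt_of_lt_of_le (by positivity) hG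
    have h₃ : |(G.card : ℝ) * G.card * (q - p)| ≤ 21 * N * η * G.card := by
      have := blockSum_shift A p q G G
      rw [abs_le] at *
      constructor <;> linarith
    rw [abs_mul, abs_of_pos (by positivity)] at h₃
    have h₄ : (G.card : ℝ) * |q - p| ≤ 21 * N * η := by
      refine le_of_mul_le_mul_right ?_ hG0
      linarith
    have h₅ : 5 / 6 * N * |q - p| ≤ 21 * N * η :=
      (mul_le_mul_of_nonneg_right hG (abs_nonneg _)).trans h₄
    refine le_of_mul_le_mul_left ?_ hN
    nlinarith [mul_nonneg hN.le hη]
  have hshift {P Q : Finset (Fin n)} {a b : ℝ} (ha : 0 ≤ a) (hP : (P.card : ℝ) ≤ a)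
      (hQ : (Q.card : ℝ) ≤ b) : |(P.card : ℝ) * Q.card * (q - p)| ≤ a * b * (26 * η) := by
    have hb : 0 ≤ b := (Nat.cast_nonneg _).trans hQ
    rw [abs_mul, abs_of_nonneg (by positivity)]
    gcongr
  have hFF {P Q : Finset (Fin n)} (hP : P ⊆ F) (hQ : Q ⊆ F)
      (hPc : (P.card : ℝ) ≤ 13 * x ∨ N - 13 * x ≤ P.card) (hQc : N - 13 * x ≤ (Q.card : ℝ)) :
      |blockSum A p P Q| ≤ N ^ 2 * κ := by
    have e : 13 * α * N = 13 * x := by rw [hx]; ring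
    exact hden P Q hP hQ (by rwa [e]) (Or.inr (by rwa [e]))
  -- the rows of `S \ Sf` lying in `F` dominate those of `Sf \ F`
  set r : Fin n → ℝ := fun i => ∑ j ∈ S, (A i j - q) with hr
  have hS0 : (0 : ℝ) < S.card := by linarith
  have hr_eq (i : Fin n) : |r i| = S.card * |q - pSi A S i| := by
    have h : r i = S.card * (pSi A S i - q) := by
      simp only [hr, pSi, Finset.sum_sub_distrib, Finset.sum_const, nsmul_eq_mul]
      field_simp
    rw [h, abs_mul, abs_of_pos hS0, abs_sub_comm]
  obtain ⟨T, hT, hTcard, hTsum⟩ := exists_half_subset_abs_sum_eq ((S \ Sf) ∩ F) r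
  have hTcut : T ⊆ S \ Sf := hT.trans Finset.inter_subset_left
  have hTS : T ⊆ S := hTcut.trans Finset.sdiff_subset
  have hT3 : (T.card : ℝ) ≤ 3 * x := by
    rw [← hcut']; exact_mod_cast Finset.card_le_card hTcut
  set Z := Sf \ F
  have hZS : Z ⊆ S := Finset.sdiff_subset.trans hSf
  have hZx : (Z.card : ℝ) ≤ x := hcomp Sf
  have hZT : Z.card ≤ T.card := by
    have h₁ := hsplit (S \ Sf) F
    have h₂ := hcomp (S \ Sf)
    have h₃ : (((S \ Sf) ∩ F).card : ℝ) ≤ 2 * T.card := by exact_mod_cast hTcard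
    have : (Z.card : ℝ) ≤ T.card := by linarith
    exact_mod_cast this
  have hTrow : |blockSum A q T S| ≤ N ^ 2 * κ + 138 * (x * N * η) := by
    have h₁ := blockSum_inter_add_sdiff_right A q T S F
    have h₂ := blockSum_shift A p q T (S ∩ F)
    have h₃ := hFF (hT.trans Finset.inter_subset_right) (Finset.inter_subset_right (s₁ := S))
      (Or.inl (by linarith)) (by linarith [hsplit S F, hcomp S])
    have h₄ := hshift (by positivity) hT3 (hle (S ∩ F))
    have h₅ := hStarBlock hTS (Finset.sdiff_subset (t := F)) hT3
      (by linarith [hcomp S])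
    rw [abs_le] at *
    constructor <;> linarith
  have hZrow : |blockSum A q Z S| ≤ N ^ 2 * κ + 138 * (x * N * η) :=
    calc |∑ i ∈ Z, r i| ≤ ∑ i ∈ Z, |r i| := Finset.abs_sum_le_sum_abs _ _
      _ ≤ ∑ j ∈ T, |r j| := by
        refine sum_le_sum_of_card_le (fun _ => abs_nonneg _) hZT fun i hi j hj => ?_
        rw [hr_eq, hr_eq]
        exact mul_le_mul_of_nonneg_left
          (htrim i (Finset.sdiff_subset hi) j (hTcut hj)) hS0.le
      _ = |blockSum A q T S| := hTsum
      _ ≤ _ := hTrow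
  have hZSf : |blockSum A p Z Sf| ≤ N ^ 2 * κ + 224 * (x * N * η) := by
    have h₁ := blockSum_inter_add_sdiff_right A q Z S Sf
    rw [Finset.inter_eq_right.2 hSf] at h₁
    have h₂ := blockSum_shift A p q Z Sf
    have h₃ := hStarBlock hZS (Finset.sdiff_subset (t := Sf)) (by linarith) hcut'.le
    have h₄ := hshift hx0.le hZx (hle Sf)
    rw [abs_le] at *
    constructor <;> linarith
  have hZZ : |blockSum A p Z Z| ≤ 46 * (x * N * η) := by
    have h₁ := blockSum_shift A p q Z Z
    have h₂ := hStarBlock hZS hZS hZx hZx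
    have h₃ := hshift hx0.le hZx (hle Z)
    rw [abs_le] at *
    constructor <;> linarith
  have hGG : |blockSum A p (Sf ∩ F) (Sf ∩ F)| ≤ N ^ 2 * κ := by
    have hc : N - 13 * x ≤ ((Sf ∩ F).card : ℝ) := by linarith [hsplit Sf F]
    exact hFF Finset.inter_subset_right Finset.inter_subset_right (Or.inr hc) hc
  have htotal : |blockSum A p Sf Sf| ≤ 3 * (N ^ 2 * κ) + 494 * (x * N * η) := by
    have h₁ := blockSum_inter_add_sdiff_right A p Sf Sf F
    have h₂ := blockSum_inter_add_sdiff_left A p Sf (Sf ∩ F) F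
    have h₃ := blockSum_inter_add_sdiff_right A p Z Sf F
    have h₄ := blockSum_comm A hA p Sf Z
    rw [abs_le] at *
    constructor <;> linarith
  have hSf8 : 4 / 5 * N ≤ (Sf.card : ℝ) := by linarith
  have hSf0 : (0 : ℝ) < Sf.card := lt_of_lt_of_le (by positivity) hSf8
  have hpS : pS A Sf - p = blockSum A p Sf Sf / (Sf.card : ℝ) ^ 2 := by
    simp only [pS, blockSum, Finset.sum_sub_distrib, Finset.sum_const, nsmul_eq_mul]
    field_simp
  rw [hpS, abs_div, abs_of_pos (pow_pos hSf0 2), div_le_iff₀ (pow_pos hSf0 2)]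
  calc |blockSum A p Sf Sf| ≤ 3 * (N ^ 2 * κ) + 494 * (x * N * η) := htotal
    _ ≤ (1000 * α * η + 5 * κ) * (4 / 5 * N) ^ 2 := by
      have h₁ : 0 ≤ N ^ 2 * κ := by positivity
      have h₂ : 0 ≤ α * N ^ 2 * η := by positivity
      rw [hx]
      linarith
    _ ≤ (1000 * α * η + 5 * κ) * (Sf.card : ℝ) ^ 2 := by gcongr
end
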